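/- (Theorem 1, part ii: intra-cluster contraction for self-attention) Suppose the index set {0,...,N} is partitioned into M ≥ 2 nonempty clusters G^1, ..., G^M, and there exist real numbers 0 ≤ ε_l ≤ ε_u such that whenever j ∈ G^m and j' ∈ G^{m'} with m ≠ m', the attention weight satisfies ε_l < a_t^{j',j} < ε_u. For each m let N_m = |G^m| and A_m = (N+1) − N_m, and set Z_t^m = {z_t^j : j ∈ G^m}, Z_{t+1}^m = {z_{t+1}^j : j ∈ G^m}. If d(Z_t) > 0, then for every m: d(Z_{t+1}^m) < (1 − A_m ε_l)² · d(Z_t^m) + A_m ε_u · d(Z_t) · (A_m ε_u + 2). -/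

import Mathlib

/-- Theorem 1(ii): intra-cluster contraction for the single-head (`W_V = I`) self-attention
update. If the index set is partitioned into `M ≥ 2` nonempty clusters and cross-cluster
attention weights lie strictly between `εl` and `εu`, then the intra-cluster diameter at the
next layer satisfies the contraction bound. -/
theorem intra_cluster_contraction
    (N D M : ℕ) (hN : 0 < N) (hD : 0 < D) (hM : 2 ≤ M)
    (z : Fin (N + 1) → EuclideanSpace ℝ (Fin D))
    (a : Fin (N + 1) → Fin (N + 1) → ℝ)
    (ha : ∀ k j, 0 ≤ a k j) (hsum : ∀ j, ∑ k, a k j = 1)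
    (w : Fin (N + 1) → EuclideanSpace ℝ (Fin D))
    (hw : ∀ j, w j = ∑ k, a k j • z k)
    (G : Fin M → Finset (Fin (N + 1)))
    (hGne : ∀ m, (G m).Nonempty)
    (hdisj : ∀ m m', m ≠ m' → Disjoint (G m) (G m'))
    (hcover : ∀ j : Fin (N + 1), ∃ m, j ∈ G m)
    (εl εu : ℝ) (hεl : 0 ≤ εl) (hεlu : εl ≤ εu)
    (hbound : ∀ m m', m ≠ m' → ∀ j ∈ G m, ∀ j' ∈ G m',
        εl < a j' j ∧ a j' j < εu)
    (hd : 0 < Metric.diam (Set.range z)) :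
    ∀ m : Fin M,
      Metric.diam (w '' ↑(G m)) <
        (1 - ((N : ℝ) + 1 - ((G m).card : ℝ)) * εl) ^ 2 * Metric.diam (z '' ↑(G m))
        + ((N : ℝ) + 1 - ((G m).card : ℝ)) * εu * Metric.diam (Set.range z)
          * (((N : ℝ) + 1 - ((G m).card : ℝ)) * εu + 2) := by
  intro m
  obtain ⟨m', hm'⟩ : ∃ m' : Fin M, m' ≠ m := by
    haveI : Nontrivial (Fin M) := Fin.nontrivial_iff_two_le.mpr hM
    exact exists_ne m
  set S := G m with hS
  have hA : ((N : ℝ) + 1 - (S.card : ℝ)) = ((Sᶜ).card : ℝ) := by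
    have h := Finset.card_add_card_compl S
    rw [Fintype.card_fin] at h
    have h2 : ((S.card + (Sᶜ).card : ℕ) : ℝ) = ((N + 1 : ℕ) : ℝ) := by rw [h]
    push_cast at h2
    linarith
  rw [hA]
  set A : ℝ := ((Sᶜ).card : ℝ) with hAdef
  have hne : (Sᶜ).Nonempty := by
    obtain ⟨x, hx⟩ := hGne m'
    exact ⟨x, Finset.mem_compl.mpr (Finset.disjoint_left.mp (hdisj m' m hm') hx)⟩
  have hcross : ∀ j ∈ S, ∀ k ∈ Sᶜ, εl < a k j ∧ a k j < εu := by
    intro j hj k hk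
    obtain ⟨m1, hm1⟩ := hcover k
    refine hbound m m1 ?_ j hj k hm1
    rintro rfl
    exact Finset.mem_compl.mp hk hm1
  set d := Metric.diam (Set.range z) with hd_def
  set e := Metric.diam (z '' (S : Set (Fin (N + 1)))) with he_def
  have he0 : 0 ≤ e := Metric.diam_nonneg
  have hbd : Bornology.IsBounded (Set.range z) := (Set.finite_range z).isBounded
  have hbe : Bornology.IsBounded (z '' (S : Set (Fin (N + 1)))) :=
    (S.finite_toSet.image z).isBounded
  let q : Fin (N + 1) → ℝ := fun j => ∑ k ∈ Sᶜ, a k j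
  let p : Fin (N + 1) → ℝ := fun j => ∑ k ∈ S, a k j
  have hpq : ∀ j, p j + q j = 1 := fun j => by
    rw [← hsum j]; exact Finset.sum_add_sum_compl S _
  have hp0 : ∀ j, 0 ≤ p j := fun j => Finset.sum_nonneg fun k _ => ha k j
  have hq0 : ∀ j, 0 ≤ q j := fun j => Finset.sum_nonneg fun k _ => ha k j
  have hql : ∀ j ∈ S, A * εl ≤ q j := by
    intro j hj
    have := Finset.card_nsmul_le_sum Sᶜ (fun k => a k j) εl (fun k hk => (hcross j hj k hk).1.le)
    rwa [nsmul_eq_mul] at this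
  have hqu : ∀ j ∈ S, q j < A * εu := by
    intro j hj
    have := Finset.sum_lt_sum_of_nonempty hne (fun k hk => (hcross j hj k hk).2)
    rwa [Finset.sum_const, nsmul_eq_mul] at this
  have key : ∀ i j, dist (w i) (w j) ≤ p i * p j * e + (1 - p i * p j) * d := by
    intro i j
    let c : Fin (N + 1) → ℝ := fun k => if k ∈ S then 1 else 0
    have hc : ∀ j, ∑ k, a k j * c k = p j := by
      intro j
      simp [c, p]
    have hww : w i - w j = ∑ k, ∑ l, (a k i * a l j) • (z k - z l) := by
      have h1 : ∑ k, ∑ l, (a k i * a l j) • z k = w i := by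
        rw [hw i]
        refine Finset.sum_congr rfl fun k _ => ?_
        rw [← Finset.sum_smul, ← Finset.mul_sum, hsum, mul_one]
      have h2 : ∑ k, ∑ l, (a k i * a l j) • z l = w j := by
        rw [hw j, Finset.sum_comm]
        refine Finset.sum_congr rfl fun k _ => ?_
        rw [← Finset.sum_smul, ← Finset.sum_mul, hsum, one_mul]
      simp only [smul_sub, Finset.sum_sub_distrib]
      rw [h1, h2]
    have hz : ∀ k l, ‖z k - z l‖ ≤ d - c k * c l * (d - e) := by
      intro k l
      rw [← dist_eq_norm]
      by_cases hk : k ∈ S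
      · by_cases hl : l ∈ S
        · have := Metric.dist_le_diam_of_mem hbe (Set.mem_image_of_mem z (Finset.mem_coe.mpr hk))
            (Set.mem_image_of_mem z (Finset.mem_coe.mpr hl))
          simpa [c, hk, hl] using this
        · simpa [c, hl] using Metric.dist_le_diam_of_mem hbd ⟨k, rfl⟩ ⟨l, rfl⟩
      · simpa [c, hk] using Metric.dist_le_diam_of_mem hbd ⟨k, rfl⟩ ⟨l, rfl⟩
    rw [dist_eq_norm, hww]
    calc ‖∑ k, ∑ l, (a k i * a l j) • (z k - z l)‖
        ≤ ∑ k, ∑ l, (a k i * a l j) * (d - c k * c l * (d - e)) := by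
          refine norm_sum_le_of_le _ fun k _ => norm_sum_le_of_le _ fun l _ => ?_
          have h0 := mul_nonneg (ha k i) (ha l j)
          rw [norm_smul, Real.norm_of_nonneg h0]
          exact mul_le_mul_of_nonneg_left (hz k l) h0
      _ = (∑ k, a k i) * (∑ l, a l j) * d
            - (∑ k, a k i * c k) * (∑ l, a l j * c l) * (d - e) := by
          rw [Finset.sum_mul_sum, Finset.sum_mul_sum, Finset.sum_mul, Finset.sum_mul,
            ← Finset.sum_sub_distrib]
          refine Finset.sum_congr rfl fun k _ => ?_
          rw [Finset.sum_mul, Finset.sum_mul, ← Finset.sum_sub_distrib]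
          refine Finset.sum_congr rfl fun l _ => ?_
          ring
      _ = p i * p j * e + (1 - p i * p j) * d := by
          rw [hsum, hsum, hc, hc]; ring
  obtain ⟨x, hx, hmax⟩ := Finset.exists_max_image S q (hGne m)
  have hle : Metric.diam (w '' (S : Set (Fin (N + 1)))) ≤ (1 - A * εl) ^ 2 * e + 2 * q x * d := by
    have h2 : 0 ≤ (1 - A * εl) ^ 2 * e + 2 * q x * d := by
      have := hq0 x
      positivity
    refine Metric.diam_le_of_forall_dist_le h2 ?_
    rintro _ ⟨i, hi, rfl⟩ _ ⟨j, hj, rfl⟩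
    have hi' := Finset.mem_coe.mp hi
    have hj' := Finset.mem_coe.mp hj
    refine (key i j).trans (add_le_add ?_ ?_)
    · refine mul_le_mul_of_nonneg_right ?_ he0
      rw [sq]
      have h3 := hql i hi'
      have h4 := hql j hj'
      have h5 := hpq i
      have h6 := hpq j
      have h7 := hp0 i
      exact mul_le_mul (by linarith) (by linarith) (hp0 j) (by linarith)
    · refine mul_le_mul_of_nonneg_right ?_ hd.le
      have e1 : p i = 1 - q i := by linarith [hpq i]
      have e2 : p j = 1 - q j := by linarith [hpq j]
      rw [e1, e2]
      nlinarith [mul_nonneg (hq0 i) (hq0 j), hmax i hi', hmax j hj']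
  refine hle.trans_lt (add_lt_add_of_le_of_lt le_rfl ?_)
  have h8 := hqu x hx
  have h9 := mul_lt_mul_of_pos_right h8 hd
  have h10 : 0 ≤ A * εu * d * (A * εu) := by
    have : 0 ≤ A * εu := (hq0 x).trans h8.le
    positivity
  nlinarith
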